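/- Let G be a finite graph on n vertices with minimum degree δ = δ(G) ≥ 1, and let ε satisfy 1/(2δ) < ε < 1/2. Form a random subgraph G1 of G by keeping each edge of G independently with probability 2ε. Then the probability that G1 has minimum degree at least ε·δ is greater than 2^{−n}. -/

import Mathlib

open SimpleGraph Finset

/-- The minimum degree of a graph. -/
noncomputable def minDeg {V : Type*} (G : SimpleGraph V) : ℕ :=
  ⨅ v : V, (G.neighborSet v).ncard

/-- The binomial probability of exactly `k` successes in `d` trials. -/
noncomputable def binomialWeight (d : ℕ) (p : ℝ) (k : ℕ) : ℝ :=
  d.choose k * p ^ k * (1 - p) ^ (d - k)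

lemma binomialWeight_nonneg {p : ℝ} (hp0 : 0 ≤ p) (hp1 : p ≤ 1) (d k : ℕ) :
    0 ≤ binomialWeight d p k := by
  have : 0 ≤ 1 - p := by linarith
  unfold binomialWeight
  positivity

lemma eval_bernsteinPolynomial (d : ℕ) (p : ℝ) (k : ℕ) :
    (bernsteinPolynomial ℝ d k).eval p = binomialWeight d p k := by
  simp [bernsteinPolynomial, binomialWeight]

lemma sum_binomialWeight (d : ℕ) (p : ℝ) :
    ∑ k ∈ range (d + 1), binomialWeight d p k = 1 := by
  simpa [Polynomial.eval_finsetSum, eval_bernsteinPolynomial] using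
    congrArg (Polynomial.eval p) (bernsteinPolynomial.sum ℝ d)

lemma sum_mul_binomialWeight (d : ℕ) (p : ℝ) :
    ∑ k ∈ range (d + 1), (k : ℝ) * binomialWeight d p k = d * p := by
  simpa [Polynomial.eval_finsetSum, eval_bernsteinPolynomial] using
    congrArg (Polynomial.eval p) (bernsteinPolynomial.sum_smul ℝ d)

lemma sum_sq_sub_mul_binomialWeight (d : ℕ) (p : ℝ) :
    ∑ k ∈ range (d + 1), (d * p - (k : ℝ)) ^ 2 * binomialWeight d p k = d * p * (1 - p) := by
  simpa [Polynomial.eval_finsetSum, eval_bernsteinPolynomial] using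
    congrArg (Polynomial.eval p) (bernsteinPolynomial.variance ℝ d)

lemma one_sub_le_exp_neg_add_sq {p : ℝ} (hp0 : 0 ≤ p) (hp1 : p < 1) :
    1 - p ≤ Real.exp (-(p + p ^ 2 / 2)) := by
  have h := Real.hasSum_pow_div_log_of_abs_lt_one (x := p) (by rwa [abs_of_nonneg hp0])
  have h2 := sum_le_hasSum (range 2) (fun i _ => by positivity) h
  rw [← Real.log_le_iff_le_exp (by linarith)]
  norm_num [Finset.sum_range_succ] at h2
  linarith

lemma two_mul_one_add_lt_exp {x : ℝ} (hx : 2 ≤ x) : 2 * (1 + x) < Real.exp x := by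
  have h := Real.sum_le_exp_of_nonneg (show 0 ≤ x by linarith) 4
  norm_num [Finset.sum_range_succ, Nat.factorial] at h
  nlinarith [pow_le_pow_left₀ (by norm_num) hx 2, pow_le_pow_left₀ (by norm_num) hx 3]

lemma binomialWeight_zero_lt_half {d : ℕ} {p : ℝ} (hp1 : p < 1) (hd : 1 < d * p) :
    binomialWeight d p 0 < 1 / 2 := by
  have h1 : (1 - p) ^ d ≤ Real.exp (-(d * p)) := by
    rw [← mul_neg, Real.exp_nat_mul]
    exact pow_le_pow_left₀ (by linarith) (Real.one_sub_le_exp_neg p) d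
  have h2 : Real.exp (-(d * p)) < Real.exp (-1) := Real.exp_lt_exp.2 (by linarith)
  have h3 : Real.exp (-1) < 1 / 2 := by
    linarith [Real.exp_neg_one_lt_d9]
  simp only [binomialWeight, Nat.choose_zero_right, pow_zero, Nat.sub_zero]
  push_cast
  linarith

lemma binomialWeight_zero_add_one_lt_half {d : ℕ} {p : ℝ} (hp0 : 0 < p) (hp1 : p < 1)
    (hd : 2 ≤ d * p) : binomialWeight d p 0 + binomialWeight d p 1 < 1 / 2 := by
  have hd2 : 2 < d := by
    have : (2 : ℝ) < d := by nlinarith [Nat.cast_nonneg (α := ℝ) d]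
    exact_mod_cast this
  obtain ⟨m, rfl⟩ : ∃ m, d = m + 1 := ⟨d - 1, by omega⟩
  have hm : (2 : ℝ) ≤ m := by exact_mod_cast (by omega : 2 ≤ m)
  push_cast at hd
  set x : ℝ := (m + 1) * p with hx
  have hsum : binomialWeight (m + 1) p 0 + binomialWeight (m + 1) p 1
      = (1 - p) ^ m * (1 + x - p) := by
    simp [binomialWeight, hx]
    ring
  have h1 : (1 - p) ^ m ≤ Real.exp (m * (-(p + p ^ 2 / 2))) := by
    rw [Real.exp_nat_mul]
    exact pow_le_pow_left₀ (by linarith) (one_sub_le_exp_neg_add_sq hp0.le hp1) m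
  have h2 : 1 + x - p ≤ (1 + x) * Real.exp (-(p / (1 + x))) := by
    have := Real.one_sub_le_exp_neg (p / (1 + x))
    calc 1 + x - p = (1 + x) * (1 - p / (1 + x)) := by field_simp
      _ ≤ _ := by gcongr
  have h3 : m * (-(p + p ^ 2 / 2)) + -(p / (1 + x)) ≤ -x := by
    have hpx : p ≤ x / 3 := by nlinarith
    have key : 1 - x / 2 + p / 2 ≤ 1 / (1 + x) := by
      rw [le_div_iff₀ (by linarith)]
      nlinarith
    have := mul_le_mul_of_nonneg_left key hp0.le
    rw [mul_one_div] at this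
    have e : m * (-(p + p ^ 2 / 2)) = -x + p - x * p / 2 + p ^ 2 / 2 := by
      rw [hx]; ring
    rw [e]
    nlinarith
  rw [hsum]
  calc (1 - p) ^ m * (1 + x - p)
      ≤ Real.exp (m * (-(p + p ^ 2 / 2))) * ((1 + x) * Real.exp (-(p / (1 + x)))) :=
        mul_le_mul h1 h2 (by linarith) (Real.exp_pos _).le
    _ = (1 + x) * Real.exp (m * (-(p + p ^ 2 / 2)) + -(p / (1 + x))) := by
        rw [Real.exp_add]; ring
    _ ≤ (1 + x) * Real.exp (-x) := by gcongr
    _ < 1 / 2 := by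
        rw [Real.exp_neg, ← div_eq_mul_inv, div_lt_iff₀ (Real.exp_pos _)]
        linarith [two_mul_one_add_lt_exp hd]

/-- A binomial random variable with mean greater than `1` is at least half its mean with
probability greater than `1/2`. -/
lemma half_lt_sum_binomialWeight {d : ℕ} {p : ℝ} (hp0 : 0 < p) (hp1 : p < 1)
    (hd : 1 < d * p) :
    1 / 2 < ∑ k ∈ range (d + 1),
      binomialWeight d p k * (if d * p / 2 ≤ (k : ℝ) then 1 else 0) := by
  have hb := binomialWeight_nonneg hp0.le hp1.le d
  have hs := sum_binomialWeight d p
  have hd1 : 1 ≤ d := by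
    by_contra! h
    obtain rfl : d = 0 := by omega
    norm_num at hd
  rcases le_or_gt (d * p) 2 with h2 | h2
  · calc (1 : ℝ) / 2 < 1 - binomialWeight d p 0 := by
          linarith [binomialWeight_zero_lt_half hp1 hd]
      _ = ∑ k ∈ range (d + 1),
          (binomialWeight d p k - if k = 0 then binomialWeight d p 0 else 0) := by
        rw [Finset.sum_sub_distrib, hs, Finset.sum_ite_eq' (range (d + 1)) 0]
        simp
      _ ≤ _ := by
        refine Finset.sum_le_sum fun k _ => ?_
        rcases Nat.eq_zero_or_pos k with rfl | hk
        · rw [if_pos rfl, sub_self]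
          exact mul_nonneg (hb 0) (by split_ifs <;> norm_num)
        · have : (1 : ℝ) ≤ k := by exact_mod_cast hk
          rw [if_neg hk.ne', if_pos (by linarith)]
          simp
  rcases le_or_gt (d * p) 4 with h4 | h4
  · calc (1 : ℝ) / 2 < 1 - binomialWeight d p 0 - binomialWeight d p 1 := by
          linarith [binomialWeight_zero_add_one_lt_half hp0 hp1 h2.le]
      _ = ∑ k ∈ range (d + 1), (binomialWeight d p k -
          (if k = 0 then binomialWeight d p 0 else 0) -
          if k = 1 then binomialWeight d p 1 else 0) := by
        rw [Finset.sum_sub_distrib, Finset.sum_sub_distrib, hs,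
          Finset.sum_ite_eq' (range (d + 1)) 0, Finset.sum_ite_eq' (range (d + 1)) 1,
          if_pos (by simp), if_pos (by simp; omega)]
      _ ≤ _ := by
        refine Finset.sum_le_sum fun k _ => ?_
        have hi : (0 : ℝ) ≤ binomialWeight d p k * (if d * p / 2 ≤ (k : ℝ) then 1 else 0) :=
          mul_nonneg (hb k) (by split_ifs <;> norm_num)
        obtain rfl | rfl | hk : k = 0 ∨ k = 1 ∨ 2 ≤ k := by omega
        · simpa using hi
        · simpa using hi
        · have : (2 : ℝ) ≤ k := by exact_mod_cast hk
          rw [if_neg (by omega), if_neg (by omega), if_pos (by linarith)]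
          simp
  · have hm := sum_mul_binomialWeight d p
    have hv := sum_sq_sub_mul_binomialWeight d p
    set x : ℝ := d * p with hx
    have hx0 : 0 < x := by linarith
    have hE : ∑ k ∈ range (d + 1), binomialWeight d p k * (1 - (k - 3 * x / 2) ^ 2 / x ^ 2)
        = 1 - (x * (1 - p) + x ^ 2 / 4) / x ^ 2 := by
      have : ∀ k ∈ range (d + 1), binomialWeight d p k * (1 - (k - 3 * x / 2) ^ 2 / x ^ 2)
          = (1 - 5 / 4) * binomialWeight d p k
            + (1 / x) * (k * binomialWeight d p k)
            - (1 / x ^ 2) * ((x - k) ^ 2 * binomialWeight d p k) := by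
        intro k _
        field_simp
        ring
      rw [Finset.sum_congr rfl this, Finset.sum_sub_distrib, Finset.sum_add_distrib,
        ← Finset.mul_sum, ← Finset.mul_sum, ← Finset.mul_sum, hs, hm, hv]
      field_simp
      ring
    calc (1 : ℝ) / 2 < 1 - (x * (1 - p) + x ^ 2 / 4) / x ^ 2 := by
          rw [lt_sub_comm, div_lt_iff₀ (by positivity)]
          nlinarith [mul_pos hx0 hp0]
      _ = _ := hE.symm
      _ ≤ _ := by
        refine Finset.sum_le_sum fun k _ => mul_le_mul_of_nonneg_left ?_ (hb k)
        split_ifs with h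
        · have : 0 ≤ ((k : ℝ) - 3 * x / 2) ^ 2 / x ^ 2 := by positivity
          linarith
        · rw [sub_nonpos, one_le_div (by positivity)]
          nlinarith

section RandomSubset

variable {α : Type*} [DecidableEq α]

/-- The probability of obtaining `S` when each element of `E` is kept independently with
probability `p`. -/
noncomputable def subsetWeight (E : Finset α) (p : ℝ) (S : Finset α) : ℝ :=
  if S ⊆ E then p ^ #S * (1 - p) ^ (#E - #S) else 0

lemma subsetWeight_nonneg {p : ℝ} (hp0 : 0 ≤ p) (hp1 : p ≤ 1) (E S : Finset α) :
    0 ≤ subsetWeight E p S := by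
  have : 0 ≤ 1 - p := by linarith
  unfold subsetWeight
  split_ifs <;> positivity

lemma subsetWeight_mul_le {p : ℝ} (hp0 : 0 ≤ p) (hp1 : p ≤ 1) (E S T : Finset α) :
    subsetWeight E p S * subsetWeight E p T ≤
      subsetWeight E p (S ∩ T) * subsetWeight E p (S ∪ T) := by
  by_cases hS : S ⊆ E
  · by_cases hT : T ⊆ E
    · have hU := union_subset hS hT
      have hI : S ∩ T ⊆ E := inter_subset_left.trans hS
      have h := card_union_add_card_inter S T
      have c1 := card_le_card hS
      have c2 := card_le_card hT
      have c3 := card_le_card hU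
      have c4 := card_le_card hI
      simp only [subsetWeight, if_pos hS, if_pos hT, if_pos hU, if_pos hI]
      rw [mul_mul_mul_comm, mul_mul_mul_comm (p ^ #(S ∩ T)), ← pow_add, ← pow_add, ← pow_add, ← pow_add]
      apply le_of_eq
      congr 2 <;> omega
    · rw [subsetWeight, subsetWeight, if_neg hT, mul_zero]
      exact mul_nonneg (subsetWeight_nonneg hp0 hp1 _ _) (subsetWeight_nonneg hp0 hp1 _ _)
  · rw [subsetWeight, if_neg hS, zero_mul]
    exact mul_nonneg (subsetWeight_nonneg hp0 hp1 _ _) (subsetWeight_nonneg hp0 hp1 _ _)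

lemma sum_subsetWeight_mul [Fintype α] (E : Finset α) (p : ℝ) (f : Finset α → ℝ) :
    ∑ S, subsetWeight E p S * f S =
      ∑ S ∈ E.powerset, p ^ #S * (1 - p) ^ (#E - #S) * f S := by
  rw [← Finset.sum_subset (subset_univ E.powerset)]
  · exact Finset.sum_congr rfl fun S hS => by rw [subsetWeight, if_pos (mem_powerset.1 hS)]
  · intro S _ hS
    rw [subsetWeight, if_neg (by simpa using hS), zero_mul]

lemma sum_powerset_union_mul_inter (I J : Finset α) (hIJ : Disjoint I J) (p : ℝ)
    (f : Finset α → ℝ) :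
    ∑ S ∈ (I ∪ J).powerset, p ^ #S * (1 - p) ^ (#(I ∪ J) - #S) * f (S ∩ I) =
      ∑ S ∈ I.powerset, p ^ #S * (1 - p) ^ (#I - #S) * f S := by
  induction J using Finset.induction_on with
  | empty =>
    rw [union_empty]
    exact Finset.sum_congr rfl fun S hS => by rw [inter_eq_left.2 (mem_powerset.1 hS)]
  | insert a J ha ih =>
    rw [disjoint_insert_right] at hIJ
    have haE : a ∉ I ∪ J := by simp [hIJ.1, ha]
    rw [union_insert, Finset.sum_powerset_insert haE, ← ih hIJ.2, ← Finset.sum_add_distrib]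
    refine Finset.sum_congr rfl fun S hS => ?_
    have hS := mem_powerset.1 hS
    have haS : a ∉ S := fun h => haE (hS h)
    have hc := card_le_card hS
    rw [card_insert_of_notMem haE, card_insert_of_notMem haS, insert_inter_of_notMem hIJ.1,
      Nat.add_sub_add_right, Nat.succ_sub hc, pow_succ, pow_succ]
    ring

lemma sum_powerset_mul_card_inter (E I : Finset α) (hI : I ⊆ E) (p : ℝ) (g : ℕ → ℝ) :
    ∑ S ∈ E.powerset, p ^ #S * (1 - p) ^ (#E - #S) * g #(S ∩ I) =
      ∑ k ∈ range (#I + 1), binomialWeight #I p k * g k := by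
  have h := sum_powerset_union_mul_inter I (E \ I) disjoint_sdiff p fun S => g #S
  rw [union_sdiff_of_subset hI] at h
  rw [h, Finset.sum_powerset_apply_card fun k => p ^ k * (1 - p) ^ (#I - k) * g k]
  refine Finset.sum_congr rfl fun k _ => ?_
  rw [binomialWeight, nsmul_eq_mul]
  ring

lemma prod_sum_subsetWeight_le [Fintype α] {ι : Type*} (s : Finset ι) (E : Finset α) {p : ℝ}
    (hp0 : 0 ≤ p) (hp1 : p ≤ 1) (f : ι → Finset α → ℝ) (hf0 : ∀ i, 0 ≤ f i)
    (hf : ∀ i, Monotone (f i)) :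
    ∏ i ∈ s, ∑ S, subsetWeight E p S * f i S ≤
      ∑ S, subsetWeight E p S * ∏ i ∈ s, f i S := by
  classical
  have hone : ∑ S, subsetWeight E p S = 1 := by
    have h1 := sum_subsetWeight_mul E p fun _ => 1
    have h2 := sum_powerset_mul_card_inter E ∅ (empty_subset E) p fun _ => 1
    have h3 := sum_binomialWeight (#(∅ : Finset α)) p
    simp only [mul_one] at h1 h2
    rw [h1, h2, h3]
  induction s using Finset.induction_on with
  | empty => simp [hone]
  | insert i s hi ih =>
    rw [prod_insert hi]
    have hpos : 0 ≤ ∑ S, subsetWeight E p S * f i S :=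
      Finset.sum_nonneg fun S _ => mul_nonneg (subsetWeight_nonneg hp0 hp1 E S) (hf0 i S)
    have h := fkg (μ := subsetWeight E p) (f := f i) (g := fun S => ∏ j ∈ s, f j S)
      (fun S => subsetWeight_nonneg hp0 hp1 E S) (hf0 i)
      (fun S => prod_nonneg fun j _ => hf0 j S) (hf i)
      (fun S T hST => prod_le_prod (fun j _ => hf0 j S) fun j _ => hf j hST)
      (subsetWeight_mul_le hp0 hp1 E)
    rw [hone, one_mul] at h
    calc _ ≤ (∑ S, subsetWeight E p S * f i S) *
          ∑ S, subsetWeight E p S * ∏ j ∈ s, f j S := by gcongr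
      _ ≤ _ := h
      _ = _ := by simp only [prod_insert hi]

end RandomSubset

lemma ncard_neighborSet_fromEdgeSet {V : Type*} [DecidableEq V] (S : Finset (Sym2 V))
    (hS : ∀ e ∈ S, ¬ e.IsDiag) (v : V) :
    ((fromEdgeSet (S : Set (Sym2 V))).neighborSet v).ncard = #{e ∈ S | v ∈ e} := by
  rw [← Set.ncard_congr' ((fromEdgeSet (S : Set (Sym2 V))).incidenceSetEquivNeighborSet v),
    ← Set.ncard_coe_finset]
  congr 1
  ext e
  simp only [incidenceSet, edgeSet_fromEdgeSet, Set.mem_ofPred_eq, Set.mem_sdiff, Finset.coe_filter,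
    mem_coe, Sym2.mem_diagSet]
  exact ⟨fun h => ⟨h.1.1, h.2⟩, fun h => ⟨⟨h.1, hS e h.1⟩, h.2⟩⟩

lemma minDeg_le_ncard {V : Type*} (G : SimpleGraph V) (v : V) :
    minDeg G ≤ (G.neighborSet v).ncard :=
  ciInf_le' _ v

lemma exists_ncard_eq_minDeg {V : Type*} [Nonempty V] (G : SimpleGraph V) :
    ∃ v, (G.neighborSet v).ncard = minDeg G :=
  ciInf_mem fun v => (G.neighborSet v).ncard

/-- Let `G` be a graph on `n` vertices with minimum degree `δ ≥ 1` and let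
`1/(2δ) < ε < 1/2`.  Keeping each edge of `G` independently with probability `2ε`, the
probability that the resulting spanning subgraph has minimum degree at least `ε·δ`
exceeds `2^{-n}`.  (The probability is written as a sum over all subsets `S` of the edge
set of `G`, the subgraph kept being the graph spanned by the edges in `S`.) -/
theorem stmt7 (n : ℕ) (G : SimpleGraph (Fin n)) [DecidableRel G.Adj] (ε : ℝ)
    (hδ : 1 ≤ minDeg G) (hε1 : 1 / (2 * (minDeg G : ℝ)) < ε) (hε2 : ε < 1 / 2) :
    ((2 : ℝ) ^ n)⁻¹ <
      ∑ S ∈ G.edgeFinset.powerset,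
        (if ε * (minDeg G : ℝ) ≤ (minDeg (fromEdgeSet (↑S : Set (Sym2 (Fin n)))) : ℝ) then
          (2 * ε) ^ S.card * (1 - 2 * ε) ^ (G.edgeFinset.card - S.card) else 0) := by
  have hn : NeZero n := ⟨by
    rintro rfl
    simp [minDeg] at hδ⟩
  set δ := minDeg G with hδdef
  have hδ' : (1 : ℝ) ≤ δ := by exact_mod_cast hδ
  have hpδ : 1 < δ * (2 * ε) := by
    rw [div_lt_iff₀ (by positivity)] at hε1
    linarith
  have hp0 : 0 < 2 * ε := by
    by_contra! h
    nlinarith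
  have hp1 : 2 * ε < 1 := by linarith
  have hdiag : ∀ S ⊆ G.edgeFinset, ∀ e ∈ S, ¬ e.IsDiag := fun S hS e he =>
    G.not_isDiag_of_mem_edgeSet (mem_edgeFinset.1 (hS he))
  let I (v : Fin n) : Finset (Sym2 (Fin n)) := {e ∈ G.edgeFinset | v ∈ e}
  let f (v : Fin n) (S : Finset (Sym2 (Fin n))) : ℝ :=
    if ε * δ ≤ (#(S ∩ I v) : ℝ) then 1 else 0
  have hf0 : ∀ v, 0 ≤ f v := fun v S => by
    simp only [f, Pi.zero_apply]
    split_ifs <;> norm_num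
  have hf : ∀ v, Monotone (f v) := fun v S T hST => by
    have : (#(S ∩ I v) : ℝ) ≤ #(T ∩ I v) := by
      exact_mod_cast card_le_card (inter_subset_inter_right hST)
    simp only [f]
    split_ifs <;> linarith
  have hI : ∀ v, δ ≤ #(I v) := fun v => by
    have h := ncard_neighborSet_fromEdgeSet G.edgeFinset (hdiag _ subset_rfl) v
    rw [coe_edgeFinset, fromEdgeSet_edgeSet] at h
    exact h ▸ minDeg_le_ncard G v
  have hv : ∀ v, 1 / 2 < ∑ S, subsetWeight G.edgeFinset (2 * ε) S * f v S := fun v => by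
    have hd : (δ : ℝ) ≤ #(I v) := by exact_mod_cast hI v
    rw [sum_subsetWeight_mul, sum_powerset_mul_card_inter G.edgeFinset (I v) (filter_subset _ _)
      (2 * ε) fun k => if ε * δ ≤ (k : ℝ) then 1 else 0]
    refine (half_lt_sum_binomialWeight hp0 hp1 (d := #(I v)) (by nlinarith)).trans_le
      (Finset.sum_le_sum fun k _ => mul_le_mul_of_nonneg_left ?_
        (binomialWeight_nonneg hp0.le hp1.le _ _))
    split_ifs with h1 h2
    · rfl
    · exact absurd (by nlinarith) h2
    · norm_num
    · rfl
  calc ((2 : ℝ) ^ n)⁻¹ = ∏ _v : Fin n, (1 / 2 : ℝ) := by simp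
    _ < ∏ v, ∑ S, subsetWeight G.edgeFinset (2 * ε) S * f v S :=
      prod_lt_prod_of_nonempty (fun _ _ => by norm_num) (fun v _ => hv v) univ_nonempty
    _ ≤ ∑ S, subsetWeight G.edgeFinset (2 * ε) S * ∏ v, f v S :=
      prod_sum_subsetWeight_le _ _ hp0.le hp1.le f hf0 hf
    _ = ∑ S ∈ G.edgeFinset.powerset, _ := sum_subsetWeight_mul _ _ _
    _ ≤ _ := by
      refine Finset.sum_le_sum fun S hS => ?_
      have hS := mem_powerset.1 hS
      have hw : 0 ≤ (2 * ε) ^ #S * (1 - 2 * ε) ^ (#G.edgeFinset - #S) := by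
        have : 0 ≤ 1 - 2 * ε := by linarith
        positivity
      obtain ⟨v, hv⟩ := exists_ncard_eq_minDeg (fromEdgeSet (S : Set (Sym2 (Fin n))))
      rw [ncard_neighborSet_fromEdgeSet S (hdiag S hS)] at hv
      have hSI : S ∩ I v = {e ∈ S | v ∈ e} := by
        rw [inter_filter, inter_eq_left.2 hS]
      split_ifs with h
      · exact mul_le_of_le_one_right hw <| prod_le_one (fun v _ => hf0 v S) fun v _ => by
          simp only [f]
          split_ifs <;> norm_num
      · rw [prod_eq_zero (mem_univ v), mul_zero]
        simp only [f]
        rw [if_neg]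
        rwa [hSI, hv]
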